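/- arXiv:2210.01532 — 2 statements merged into one kernel-verified Lean document; each statement's English description precedes it below -/
import Mathlib

section
/- Let h be a Legendre function on ℝ^d, let x ∈ int dom h, and let (x_k)_{k∈ℕ} be a sequence in int dom h that converges to a point on the boundary of dom h. Then D_h(x, x_k) → ∞ as k → ∞. -/
open scoped RealInnerProductSpace
open Filter Topology Set

noncomputable section

/-- A Legendre function on ℝ^d: proper (nonempty effective domain, real-valued there),
closed (closed epigraph), convex, with nonempty interior of its domain, differentiable and
strictly convex on the interior of its domain, and with gradients blowing up along sequences
converging to boundary points of the domain. -/
structure LegendreFn (d : ℕ) where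
  dom : Set (EuclideanSpace ℝ (Fin d))
  f : EuclideanSpace ℝ (Fin d) → ℝ
  grad : EuclideanSpace ℝ (Fin d) → EuclideanSpace ℝ (Fin d)
  dom_nonempty : dom.Nonempty
  dom_convex : Convex ℝ dom
  interior_nonempty : (interior dom).Nonempty
  convexOn : ConvexOn ℝ dom f
  closed_epigraph : IsClosed {p : EuclideanSpace ℝ (Fin d) × ℝ | p.1 ∈ dom ∧ f p.1 ≤ p.2}
  diff : ∀ x ∈ interior dom, HasGradientAt f (grad x) x
  strictConvexOn : StrictConvexOn ℝ (interior dom) f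
  grad_blowup : ∀ (y : ℕ → EuclideanSpace ℝ (Fin d)) (z : EuclideanSpace ℝ (Fin d)),
      (∀ j, y j ∈ interior dom) → z ∈ frontier dom →
      Tendsto y atTop (nhds z) →
      Tendsto (fun j => ‖grad (y j)‖) atTop atTop

/-- The Bregman divergence D_h(x, y) = h(x) − h(y) − ⟨∇h(y), x − y⟩. -/
def bregman {d : ℕ} (h : LegendreFn d) (x y : EuclideanSpace ℝ (Fin d)) : ℝ :=
  h.f x - h.f y - ⟪h.grad y, x - y⟫

/-- A proper closed convex function on ℝ^d, modeled as a real-valued function on its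
(nonempty) effective domain, equal to +∞ outside; closedness is encoded by the epigraph
being closed. -/
structure ProperConvexFn (d : ℕ) where
  dom : Set (EuclideanSpace ℝ (Fin d))
  f : EuclideanSpace ℝ (Fin d) → ℝ
  dom_nonempty : dom.Nonempty
  convexOn : ConvexOn ℝ dom f
  closed_epigraph : IsClosed {p : EuclideanSpace ℝ (Fin d) × ℝ | p.1 ∈ dom ∧ f p.1 ≤ p.2}

/-- g is a subgradient of f at x: f(y) ≥ f(x) + ⟨g, y − x⟩ for all y (the inequality is
trivial outside the effective domain, where f is +∞). -/
def IsSubgradientAt {d : ℕ} (F : ProperConvexFn d) (g x : EuclideanSpace ℝ (Fin d)) : Prop :=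
  ∀ y ∈ F.dom, F.f x + ⟪g, y - x⟫ ≤ F.f y

/-- A (not necessarily Euclidean) norm on ℝ^d. -/
structure NormFn (d : ℕ) where
  N : EuclideanSpace ℝ (Fin d) → ℝ
  eq_zero_iff : ∀ x, N x = 0 ↔ x = 0
  smul : ∀ (a : ℝ) (x : EuclideanSpace ℝ (Fin d)), N (a • x) = |a| * N x
  triangle : ∀ x y, N (x + y) ≤ N x + N y

/-- The dual norm ‖g‖_* = sup{⟨g, u⟩ : ‖u‖ ≤ 1}. -/
def NormFn.dual {d : ℕ} (P : NormFn d) (g : EuclideanSpace ℝ (Fin d)) : ℝ :=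
  sSup {r : ℝ | ∃ u, P.N u ≤ 1 ∧ r = ⟪g, u⟫}

/-- x₊ = T(x; η): a minimizer over y ∈ X of ⟨g, y − x⟩ + D_h(y, x)/η
(the objective being +∞ outside dom h). -/
def IsMirrorStep {d : ℕ} (h : LegendreFn d) (X : Set (EuclideanSpace ℝ (Fin d)))
    (g x : EuclideanSpace ℝ (Fin d)) (η : ℝ) (xp : EuclideanSpace ℝ (Fin d)) : Prop :=
  xp ∈ X ∩ h.dom ∧ ∀ y ∈ X ∩ h.dom,
    ⟪g, xp - x⟫ + bregman h xp x / η ≤ ⟪g, y - x⟫ + bregman h y x / η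

/-- A convex function lies above its tangent hyperplanes. -/
theorem ConvexOn.add_inner_gradient_le {E : Type*} [NormedAddCommGroup E]
    [InnerProductSpace ℝ E] [CompleteSpace E] {s : Set E} {f : E → ℝ} {g y u : E}
    (hf : ConvexOn ℝ s f) (hy : y ∈ s) (hu : u ∈ s) (hg : HasGradientAt f g y) :
    f y + ⟪g, u - y⟫ ≤ f u := by
  have hline : HasDerivAt (f ∘ AffineMap.lineMap (k := ℝ) y u) ⟪g, u - y⟫ 0 := by
    have hg' : HasFDerivAt f (InnerProductSpace.toDual ℝ E g)
        (AffineMap.lineMap (k := ℝ) y u 0) := by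
      simpa using hg.hasFDerivAt
    simpa using hg'.comp_hasDerivAt (0 : ℝ) AffineMap.hasDerivAt_lineMap
  have h := (hf.comp_affineMap (AffineMap.lineMap (k := ℝ) y u)).le_slope_of_hasDerivAt
    (x := 0) (y := 1) (by simpa using hy) (by simpa using hu) one_pos hline
  simp only [slope_def_field, Function.comp_apply, AffineMap.lineMap_apply_one,
    AffineMap.lineMap_apply_zero, sub_zero, div_one] at h
  linarith

/-- If `h` is Legendre, `x ∈ int dom h`, and a sequence `(x_k)` in `int dom h` converges to
a point on the boundary of `dom h`, then `D_h(x, x_k) → ∞`. -/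
theorem bregman_tendsto_atTop_of_tendsto_boundary {d : ℕ} (h : LegendreFn d)
    (x : EuclideanSpace ℝ (Fin d)) (hx : x ∈ interior h.dom)
    (xk : ℕ → EuclideanSpace ℝ (Fin d)) (hxk : ∀ k, xk k ∈ interior h.dom)
    (z : EuclideanSpace ℝ (Fin d)) (hz : z ∈ frontier h.dom)
    (hconv : Tendsto xk atTop (𝓝 z)) :
    Tendsto (fun k => bregman h x (xk k)) atTop atTop := by
  obtain ⟨ε, hε, hball⟩ : ∃ ε > 0, ∀ u ∈ Metric.ball x ε, u ∈ h.dom ∧ h.f u < h.f x + 1 := by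
    have hcont : ContinuousAt h.f x := (h.diff x hx).hasFDerivAt.continuousAt
    exact Metric.eventually_nhds_iff_ball.mp
      ((eventually_mem_set.mpr (mem_interior_iff_mem_nhds.mp hx)).and
        (hcont.eventually_lt_const (lt_add_one _)))
  have hlower (k : ℕ) : ε / 2 * ‖h.grad (xk k)‖ + -1 ≤ bregman h x (xk k) := by
    set g := h.grad (xk k)
    have hnorm : ‖(ε / 2) • (‖g‖⁻¹ • g)‖ < ε := by
      have hunit : ‖‖g‖⁻¹ • g‖ ≤ 1 := by
        rw [norm_smul, norm_inv, norm_norm]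
        exact inv_mul_le_one
      rw [norm_smul, Real.norm_of_nonneg (by positivity)]
      nlinarith
    obtain ⟨hu, hfu⟩ := hball (x + (ε / 2) • (‖g‖⁻¹ • g)) (by simpa using hnorm)
    have htangent := h.convexOn.add_inner_gradient_le (interior_subset (hxk k)) hu
      (h.diff _ (hxk k))
    have hinner : ⟪g, (ε / 2) • (‖g‖⁻¹ • g)⟫ = ε / 2 * ‖g‖ := by
      rw [real_inner_smul_right, real_inner_smul_right, real_inner_self_eq_norm_sq]
      rcases eq_or_ne ‖g‖ 0 with hg | hg
      · simp [hg]
      · field_simp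
    rw [add_sub_right_comm, inner_add_right, hinner] at htangent
    unfold bregman
    linarith
  exact tendsto_atTop_mono hlower <| tendsto_atTop_add_const_right _ _ <|
    (h.grad_blowup xk z hxk hz hconv).const_mul_atTop (half_pos hε)
end
end

section
/- Let x ∈ X ∩ int dom h, let g(x) be a subgradient of f at x, let η > 0, and let x_+ = T(x; η) be a minimizer over y ∈ X of ⟨g(x), y − x⟩ + D_h(y, x)/η. Then x_+ ∈ X ∩ int dom h, and for every y ∈ X ∩ dom h with f(y) < ∞ one has η(f(x) − f(y)) ≤ D_h(y, x) − D_h(y, x_+) + (η²/2)‖g(x)‖_*². -/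
open scoped RealInnerProductSpace
open Filter Topology Set

noncomputable section

section Gradient

variable {E : Type*} [NormedAddCommGroup E] [InnerProductSpace ℝ E] [CompleteSpace E]
  {s : Set E} {φ : E → ℝ} {v x y : E}

/-- First-order optimality condition on a convex set. -/
theorem IsMinOn.inner_gradient_nonneg (hmin : IsMinOn φ s x) (hs : Convex ℝ s)
    (hφ : HasGradientAt φ v x) (hx : x ∈ s) (hy : y ∈ s) : 0 ≤ ⟪v, y - x⟫ := by
  simpa using hmin.localize.hasFDerivWithinAt_nonneg hφ.hasFDerivAt.hasFDerivWithinAt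
    (sub_mem_posTangentConeAt_of_segment_subset (hs.segment_subset hx hy))

/-- The gradient of a convex function is a subgradient. -/
theorem ConvexOn.add_inner_gradient_le_s3 (hconv : ConvexOn ℝ s φ) (hφ : HasGradientAt φ v x)
    (hx : x ∈ s) (hy : y ∈ s) : φ x + ⟪v, y - x⟫ ≤ φ y := by
  have hlim := (hφ.hasFDerivAt.hasLineDerivAt (y - x)).tendsto_slope_zero_right
  suffices h : ⟪v, y - x⟫ ≤ φ y - φ x by linarith
  refine le_of_tendsto (by simpa using hlim) ?_
  filter_upwards [Ioo_mem_nhdsGT (zero_lt_one' ℝ)] with t ht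
  have hc := hconv.2 hx hy (by linarith [ht.2] : 0 ≤ 1 - t) ht.1.le (by ring)
  rw [show (1 - t) • x + t • y = x + t • (y - x) by module] at hc
  simp only [smul_eq_mul] at hc ⊢
  rw [inv_mul_le_iff₀ ht.1]
  linarith

end Gradient

namespace NormFn

variable {d : ℕ} (P : NormFn d)

/-- The norm as a seminorm in the sense of Mathlib. -/
def toSeminorm : Seminorm ℝ (EuclideanSpace ℝ (Fin d)) :=
  Seminorm.of P.N P.triangle (by simpa using P.smul)

theorem nonneg (u : EuclideanSpace ℝ (Fin d)) : 0 ≤ P.N u :=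
  apply_nonneg P.toSeminorm u

theorem continuous : Continuous P.N := by
  have h : ConvexOn ℝ univ P.N := P.toSeminorm.convexOn
  exact h.locallyLipschitz.continuous

theorem exists_pos_mul_norm_le :
    ∃ c > 0, ∀ u : EuclideanSpace ℝ (Fin d), c * ‖u‖ ≤ P.N u := by
  obtain ⟨c, hc, hle⟩ :=
    (isCompact_sphere (0 : EuclideanSpace ℝ (Fin d)) 1).exists_forall_le'
      P.continuous.continuousOn (a := 0) fun u hu =>
        (P.nonneg u).lt_of_ne' fun h0 => by simp [(P.eq_zero_iff u).1 h0] at hu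
  refine ⟨c, hc, fun u => ?_⟩
  rcases eq_or_ne u 0 with rfl | hu
  · simpa using P.nonneg 0
  have hpos : 0 < ‖u‖ := norm_pos_iff.2 hu
  have h := hle (‖u‖⁻¹ • u) (by simp [norm_smul, hpos.ne'])
  rw [P.smul, abs_of_pos (inv_pos.2 hpos), le_inv_mul_iff₀ hpos] at h
  linarith

theorem inner_le_dual_mul (g u : EuclideanSpace ℝ (Fin d)) : ⟪g, u⟫ ≤ P.dual g * P.N u := by
  rcases eq_or_ne u 0 with rfl | hu
  · simp [(P.eq_zero_iff 0).2 rfl]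
  have hpos : 0 < P.N u := (P.nonneg u).lt_of_ne' fun h => hu ((P.eq_zero_iff u).1 h)
  have hbdd : BddAbove {r : ℝ | ∃ w, P.N w ≤ 1 ∧ r = ⟪g, w⟫} := by
    obtain ⟨c, hc, hle⟩ := P.exists_pos_mul_norm_le
    refine ⟨‖g‖ * c⁻¹, ?_⟩
    rintro _ ⟨w, hw, rfl⟩
    have hwc : ‖w‖ ≤ c⁻¹ := by
      rw [← one_div, le_div_iff₀ hc]
      linarith [hle w]
    exact (real_inner_le_norm g w).trans (by gcongr)
  have h : ⟪g, (P.N u)⁻¹ • u⟫ ≤ P.dual g :=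
    le_csSup hbdd ⟨_, by rw [P.smul, abs_of_pos (inv_pos.2 hpos), inv_mul_cancel₀ hpos.ne'], rfl⟩
  rw [real_inner_smul_right, inv_mul_le_iff₀ hpos] at h
  linarith

end NormFn

namespace LegendreFn

variable {d : ℕ} (h : LegendreFn d)

theorem add_inner_grad_le {u w : EuclideanSpace ℝ (Fin d)} (hu : u ∈ interior h.dom)
    (hw : w ∈ h.dom) : h.f u + ⟪h.grad u, w - u⟫ ≤ h.f w :=
  h.convexOn.add_inner_gradient_le_s3 (h.diff u hu) (interior_subset hu) hw

theorem bregman_three_point (x y z : EuclideanSpace ℝ (Fin d)) :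
    bregman h y x - bregman h y z - bregman h z x = ⟪h.grad z - h.grad x, y - z⟫ := by
  simp only [bregman, inner_sub_left, inner_sub_right]
  ring

/-- If a linear perturbation of a Legendre function is minimal at `z` on the segment from `z` to
an interior point of the domain, then `z` is an interior point too. -/
theorem mem_interior_of_min_segment {c x z : EuclideanSpace ℝ (Fin d)}
    (hx : x ∈ interior h.dom) (hz : z ∈ h.dom)
    (hmin : ∀ t ∈ Ioc (0 : ℝ) 1,
      ⟪c, z⟫ + h.f z ≤ ⟪c, z + t • (x - z)⟫ + h.f (z + t • (x - z))) :
    z ∈ interior h.dom := by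
  by_contra hzi
  have hfront : z ∈ frontier h.dom := ⟨subset_closure hz, hzi⟩
  obtain ⟨r, hr, hball⟩ : ∃ r > 0, ∀ w, ‖w‖ ≤ r → x + w ∈ h.dom ∧ h.f (x + w) ≤ h.f x + 1 := by
    have hev : ∀ᶠ w in 𝓝 x, w ∈ h.dom ∧ h.f w ≤ h.f x + 1 :=
      Filter.Eventually.and (mem_interior_iff_mem_nhds.1 hx)
        ((h.diff x hx).differentiableAt.continuousAt.eventually_le_const (by linarith))
    obtain ⟨r, hr, hsub⟩ := Metric.nhds_basis_closedBall.eventually_iff.1 hev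
    exact ⟨r, hr, fun w hw => hsub (by simpa using hw)⟩
  set p : ℝ → EuclideanSpace ℝ (Fin d) := fun t => z + t • (x - z) with hp
  have hpint : ∀ t ∈ Ioc (0 : ℝ) 1, p t ∈ interior h.dom := fun t ht =>
    h.dom_convex.add_smul_sub_mem_interior hz hx ht
  have hbound : ∀ t ∈ Ioc (0 : ℝ) 1,
      r * ‖h.grad (p t)‖ ≤ h.f x + 1 - h.f z + ⟪c, x - z⟫ := by
    intro t ht
    have h1 := h.add_inner_grad_le (hpint t ht) hz
    have h2 := hmin t ht
    rw [show z - p t = (-t) • (x - z) by simp [hp], real_inner_smul_right] at h1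
    rw [inner_add_right, real_inner_smul_right] at h2
    have h3 : -⟪h.grad (p t), x - z⟫ ≤ ⟪c, x - z⟫ := by
      refine le_of_mul_le_mul_left ?_ ht.1
      linarith
    set G := h.grad (p t) with hG
    set w := (r * ‖G‖⁻¹) • G with hw
    have hwn : ‖w‖ ≤ r := by
      rw [hw, norm_smul, Real.norm_of_nonneg (by positivity), mul_assoc]
      exact mul_le_of_le_one_right hr.le (inv_mul_le_one)
    have hGw : ⟪G, w⟫ = r * ‖G‖ := by
      rw [hw, real_inner_smul_right, real_inner_self_eq_norm_sq]
      rcases eq_or_ne ‖G‖ 0 with h0 | h0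
      · simp [h0]
      · field_simp
    have h4 := h.add_inner_grad_le (hpint t ht) (hball w hwn).1
    rw [show x + w - p t = (1 - t) • (x - z) + w by simp only [hp]; module, inner_add_right,
      real_inner_smul_right, ← hG, hGw] at h4
    have h5 := (hball w hwn).2
    have h6 := mul_le_mul_of_nonneg_left h3 (by linarith [ht.2] : 0 ≤ 1 - t)
    linarith
  have hseq : ∀ j : ℕ, 1 / ((j : ℝ) + 1) ∈ Ioc (0 : ℝ) 1 := fun j =>
    ⟨Nat.one_div_pos_of_nat, by simpa using Nat.one_div_le_one_div (α := ℝ) (Nat.zero_le j)⟩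
  have hlim : Tendsto (fun j : ℕ => p (1 / ((j : ℝ) + 1))) atTop (𝓝 z) := by
    have hcont : Continuous p := by fun_prop
    simpa [hp, Function.comp_def] using
      (hcont.tendsto 0).comp (tendsto_one_div_add_atTop_nhds_zero_nat (𝕜 := ℝ))
  obtain ⟨j, hj⟩ := ((h.grad_blowup _ z (fun j => hpint _ (hseq j)) hfront hlim).eventually_gt_atTop
    ((h.f x + 1 - h.f z + ⟪c, x - z⟫) / r)).exists
  rw [div_lt_iff₀ hr] at hj
  linarith [hbound _ (hseq j)]

end LegendreFn

namespace IsMirrorStep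

variable {d : ℕ} {h : LegendreFn d} {X : Set (EuclideanSpace ℝ (Fin d))}
  {g x xp : EuclideanSpace ℝ (Fin d)} {η : ℝ}

/-- A mirror step minimizes the linear perturbation of `h` by `η g - ∇h(x)`. -/
theorem isMinOn (hxp : IsMirrorStep h X g x η xp) (hη : 0 < η) :
    IsMinOn (fun y => ⟪η • g - h.grad x, y⟫ + h.f y) (X ∩ h.dom) xp := by
  intro y hy
  have h1 := mul_le_mul_of_nonneg_left (hxp.2 y hy) hη.le
  rw [mul_add, mul_add, mul_div_cancel₀ _ hη.ne', mul_div_cancel₀ _ hη.ne'] at h1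
  simp only [bregman, inner_sub_right] at h1
  simp only [mem_ofPred_eq, inner_sub_left, real_inner_smul_left]
  linarith

theorem mem_interior (hxp : IsMirrorStep h X g x η xp) (hη : 0 < η) (hX : Convex ℝ X)
    (hx : x ∈ X ∩ interior h.dom) : xp ∈ interior h.dom :=
  h.mem_interior_of_min_segment hx.2 hxp.1.2 fun _ ht =>
    hxp.isMinOn hη ⟨hX.add_smul_sub_mem hxp.1.1 hx.1 (Ioc_subset_Icc_self ht),
      h.dom_convex.add_smul_sub_mem hxp.1.2 (interior_subset hx.2) (Ioc_subset_Icc_self ht)⟩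

theorem inner_nonneg (hxp : IsMirrorStep h X g x η xp) (hη : 0 < η) (hX : Convex ℝ X)
    (hint : xp ∈ interior h.dom) {y : EuclideanSpace ℝ (Fin d)} (hy : y ∈ X ∩ h.dom) :
    0 ≤ ⟪η • g - h.grad x + h.grad xp, y - xp⟫ := by
  refine (hxp.isMinOn hη).inner_gradient_nonneg (hX.inter h.dom_convex) ?_ hxp.1 hy
  rw [hasGradientAt_iff_hasFDerivAt, map_add]
  exact (InnerProductSpace.toDual ℝ _ (η • g - h.grad x)).hasFDerivAt.add
    (h.diff xp hint).hasFDerivAt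

end IsMirrorStep

/-- The mirror descent step inequality: if `x ∈ X ∩ int dom h`, `g` is a subgradient of `f`
at `x`, `η > 0`, and `x₊ = T(x; η)`, then `x₊ ∈ X ∩ int dom h` and for every
`y ∈ X ∩ dom h` with `f(y) < ∞`,
`η (f(x) − f(y)) ≤ D_h(y, x) − D_h(y, x₊) + (η²/2) ‖g‖²_*`. -/
theorem mirror_step_inequality {d : ℕ} (F : ProperConvexFn d) (h : LegendreFn d) (P : NormFn d)
    (X : Set (EuclideanSpace ℝ (Fin d)))
    (hXne : X.Nonempty) (hXcl : IsClosed X) (hXcv : Convex ℝ X)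
    (hA2 : X ∩ F.dom ⊆ closure h.dom)
    (hA3 : X ∩ interior h.dom ⊆ intrinsicInterior ℝ F.dom)
    (hA4 : ∀ u ∈ X ∩ interior h.dom, ∀ v ∈ X ∩ interior h.dom,
      (1 / 2) * (P.N (u - v)) ^ 2 ≤ bregman h u v)
    (x g : EuclideanSpace ℝ (Fin d)) (hx : x ∈ X ∩ interior h.dom)
    (hg : IsSubgradientAt F g x) (η : ℝ) (hη : 0 < η)
    (xp : EuclideanSpace ℝ (Fin d)) (hxp : IsMirrorStep h X g x η xp) :
    xp ∈ X ∩ interior h.dom ∧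
      ∀ y ∈ X ∩ h.dom, y ∈ F.dom →
        η * (F.f x - F.f y) ≤
          bregman h y x - bregman h y xp + η ^ 2 / 2 * (P.dual g) ^ 2 := by
  have hint := hxp.mem_interior hη hXcv hx
  refine ⟨⟨hxp.1.1, hint⟩, fun y hy hyF => ?_⟩
  have hopt := hxp.inner_nonneg hη hXcv hint hy
  have h3 := h.bregman_three_point x y xp
  have hsc := hA4 xp ⟨hxp.1.1, hint⟩ x hx
  have hsub := mul_le_mul_of_nonneg_left (hg y hyF) hη.le
  have hdual := mul_le_mul_of_nonneg_left (P.inner_le_dual_mul g (x - xp)) hη.le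
  have hsymm : P.N (x - xp) = P.N (xp - x) := by
    simpa using P.smul (-1) (xp - x)
  rw [hsymm] at hdual
  simp only [inner_sub_left, inner_sub_right, inner_add_left, real_inner_smul_left]
    at hopt h3 hsub hdual
  nlinarith [sq_nonneg (η * P.dual g - P.N (xp - x))]
end
end
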